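/- arXiv:math/0405462 — 5 statements merged into one kernel-verified Lean document; each statement's English description precedes it below -/
import Mathlib

section
/- Let G be a finitely generated group that is residually finite, i.e., for every element g ≠ 1 of G there exist a finite group Q and a group homomorphism f : G → Q with f(g) ≠ 1. Then G is Hopfian: every surjective group homomorphism φ : G → G is injective (hence an automorphism of G). -/
/-- A finitely generated group has only finitely many homomorphisms to a given finite group. -/
theorem MonoidHom.finite_of_fg (G Q : Type*) [Group G] [Group Q] [Finite Q] (hfg : Group.FG G) :
    Finite (G →* Q) := by
  obtain ⟨S, hS, hfin⟩ := Group.fg_iff.mp hfg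
  have : Finite S := hfin
  refine Finite.of_injective (fun (f : G →* Q) (s : S) ↦ f s) fun f g hfg ↦ ?_
  exact MonoidHom.eq_of_eqOn_dense hS fun s hs ↦ congrFun hfg ⟨s, hs⟩

/-- Mal'cev's theorem: a finitely generated residually finite group is Hopfian.
Residual finiteness is stated explicitly: for every `g ≠ 1` there are a finite group `Q`
and a homomorphism `f : G →* Q` with `f g ≠ 1`. -/
theorem fg_residually_finite_is_hopfian (G : Type*) [Group G] (hfg : Group.FG G)
    (hrf : ∀ g : G, g ≠ 1 → ∃ (Q : Type) (_ : Group Q) (_ : Finite Q) (f : G →* Q), f g ≠ 1)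
    (φ : G →* G) (hφ : Function.Surjective φ) :
    Function.Injective φ := by
  rw [injective_iff_map_eq_one]
  intro g hg
  by_contra hne
  obtain ⟨Q, _, _, f, hf⟩ := hrf g hne
  have := MonoidHom.finite_of_fg G Q hfg
  have hinj : Function.Injective fun h : G →* Q ↦ h.comp φ :=
    fun _ _ h ↦ (MonoidHom.cancel_right hφ).mp h
  obtain ⟨h, rfl⟩ := Finite.surjective_of_injective hinj f
  exact hf (by simp [hg])
end

section
/- Let n be a natural number. Every surjective group homomorphism φ : FreeGroup (Fin n) → FreeGroup (Fin n) is injective, i.e., free groups of finite rank are Hopfian. More generally, any surjective group homomorphism between free groups of the same finite rank n is an isomorphism. -/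
/-- Left multiplication by `a`, restricted to a finite subset `S` of a group, extends to a
permutation of `S`. -/
theorem Finset.exists_perm_extending_mul_left {G : Type*} [Group G] (S : Finset G) (a : G) :
    ∃ p : Equiv.Perm S, ∀ x y : S, a * x = y → p x = y := by
  classical
  obtain ⟨p, hp⟩ := Finset.exists_equiv_extend_of_card_eq (α := S) (t := S)
    (s := {x : S | a * (x : G) ∈ S}) (f := fun x => a * (x : G)) (by simp)
    (by intro y hy
        obtain ⟨x, hx, rfl⟩ := Finset.mem_image.mp hy
        exact (Finset.mem_filter.mp hx).2)
    (fun x _ y _ h => Subtype.ext (mul_left_cancel h))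
  refine ⟨p, fun x y h => Subtype.ext ?_⟩
  rw [hp x (Finset.mem_filter.mpr ⟨Finset.mem_univ x, h ▸ y.2⟩), h]

/-- Every nontrivial element of a free group acts nontrivially in some action of the free group
on a finite set. -/
theorem FreeGroup.exists_hom_perm_ne_one {α : Type*} {g : FreeGroup α} (hg : g ≠ 1) :
    ∃ (S : Finset (FreeGroup α)) (f : FreeGroup α →* Equiv.Perm S), f g ≠ 1 := by
  classical
  obtain ⟨L, rfl⟩ := Quot.exists_rep g
  let S : Finset (FreeGroup α) := (L.tails.map FreeGroup.mk).toFinset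
  have hS : ∀ M, M <:+ L → FreeGroup.mk M ∈ S := fun M hM =>
    List.mem_toFinset.mpr (List.mem_map_of_mem ((List.mem_tails M L).mpr hM))
  choose p hp using fun a : α => S.exists_perm_extending_mul_left (FreeGroup.of a)
  have h_act : ∀ M (hM : M <:+ L), FreeGroup.lift p (FreeGroup.mk M)
      ⟨FreeGroup.mk [], hS [] List.nil_suffix⟩ = ⟨FreeGroup.mk M, hS M hM⟩ := by
    intro M
    induction M with
    | nil => intro hM; exact DFunLike.congr_fun (MonoidHom.map_one (FreeGroup.lift p)) _
    | cons x M ih =>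
      intro hM
      have hM' : M <:+ L := (List.suffix_cons x M).trans hM
      obtain ⟨a, b⟩ := x
      cases b with
      | true =>
        have hcons : FreeGroup.lift p (FreeGroup.mk ((a, true) :: M)) =
            FreeGroup.lift p (FreeGroup.of a) * FreeGroup.lift p (FreeGroup.mk M) :=
          _root_.map_mul (FreeGroup.lift p) (FreeGroup.of a) (FreeGroup.mk M)
        rw [hcons, Equiv.Perm.mul_apply, ih hM', FreeGroup.lift_apply_of]
        exact hp a _ _ rfl
      | false =>
        have hcons : FreeGroup.lift p (FreeGroup.mk ((a, false) :: M)) =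
            FreeGroup.lift p (FreeGroup.of a)⁻¹ * FreeGroup.lift p (FreeGroup.mk M) :=
          _root_.map_mul (FreeGroup.lift p) (FreeGroup.of a)⁻¹ (FreeGroup.mk M)
        rw [hcons, Equiv.Perm.mul_apply, ih hM', _root_.map_inv, FreeGroup.lift_apply_of,
          Equiv.Perm.inv_eq_iff_eq]
        exact (hp a _ _ (mul_inv_cancel_left (FreeGroup.of a) (FreeGroup.mk M))).symm
  refine ⟨S, FreeGroup.lift p, fun h => hg ?_⟩
  have h_one := h_act L List.suffix_rfl
  rw [show FreeGroup.lift p (FreeGroup.mk L) = 1 from h] at h_one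
  exact (congrArg Subtype.val h_one).symm

/-- Free groups of finite rank are Hopfian. -/
theorem FreeGroup.injective_of_surjective {α : Type*} [Finite α]
    (φ : FreeGroup α →* FreeGroup α) (hφ : Function.Surjective φ) : Function.Injective φ := by
  rw [injective_iff_map_eq_one]
  intro g hg
  by_contra hne
  obtain ⟨S, f, hf⟩ := FreeGroup.exists_hom_perm_ne_one hne
  have : Finite (FreeGroup α →* Equiv.Perm S) := Finite.of_equiv _ FreeGroup.lift
  have h_inj : Function.Injective fun k : FreeGroup α →* Equiv.Perm S => k.comp φ :=
    fun _ _ h => (MonoidHom.cancel_right hφ).mp h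
  obtain ⟨k, rfl⟩ := Finite.surjective_of_injective h_inj f
  exact hf (by simp [hg])

/-- Free groups of finite rank are Hopfian: every surjective endomorphism of
`FreeGroup (Fin n)` is injective; more generally, any surjective homomorphism between
free groups on (finite) generating sets of the same cardinality `n` is bijective,
hence an isomorphism. -/
theorem freeGroup_fin_rank_hopfian (n : ℕ) :
    (∀ φ : FreeGroup (Fin n) →* FreeGroup (Fin n),
      Function.Surjective φ → Function.Injective φ) ∧
    (∀ (α β : Type) (_ : Fintype α) (_ : Fintype β),
      Nat.card α = n → Nat.card β = n →
      ∀ φ : FreeGroup α →* FreeGroup β, Function.Surjective φ → Function.Bijective φ) := by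
  refine ⟨fun φ => FreeGroup.injective_of_surjective φ, ?_⟩
  intro α β _ _ hα hβ φ hφ
  let e : FreeGroup β ≃* FreeGroup α :=
    FreeGroup.freeGroupCongr (Finite.card_eq.mp (hβ.trans hα.symm)).some
  have h_inj := FreeGroup.injective_of_surjective (e.toMonoidHom.comp φ) (e.surjective.comp hφ)
  exact ⟨Function.Injective.of_comp (f := e) h_inj, hφ⟩
end

section
/- Let φ : G → H be a surjective group homomorphism. Suppose the commutator subgroup [G,G] is isomorphic to the free group FreeGroup (Fin (2·g₁)) and the commutator subgroup [H,H] is isomorphic to the free group FreeGroup (Fin (2·g₂)), for natural numbers g₁, g₂. Then g₂ ≤ g₁. -/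
/-- A surjection between free groups of finite rank cannot increase the rank, since precomposition
with it embeds the homomorphisms into a group of order two. -/
theorem FreeGroup.card_le_of_surjective {α β : Type*} [Fintype α] [Fintype β]
    (f : FreeGroup α →* FreeGroup β) (hf : Function.Surjective f) :
    Fintype.card β ≤ Fintype.card α := by
  classical
  let A := Multiplicative (ZMod 2)
  have hinj : Function.Injective
      fun v : β → A => (FreeGroup.lift (β := A)).symm ((FreeGroup.lift v).comp f) := by
    intro v w h
    exact FreeGroup.lift.injective
      ((MonoidHom.cancel_right hf).1 (FreeGroup.lift.symm.injective h))
  have hcard := Fintype.card_le_of_injective _ hinj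
  have hA : Fintype.card A = 2 := by simp [A]
  rw [Fintype.card_fun, Fintype.card_fun, hA] at hcard
  exact (Nat.pow_le_pow_iff_right one_lt_two).1 hcard

theorem map_commutator_eq_of_surjective {G H : Type*} [Group G] [Group H] (φ : G →* H)
    (hφ : Function.Surjective φ) : (commutator G).map φ = commutator H := by
  rw [map_commutator_eq, MonoidHom.range_eq_top.2 hφ, commutator_def]


/-- If `φ : G →* H` is surjective, the commutator subgroup of `G` is free of rank `2·g₁`
and the commutator subgroup of `H` is free of rank `2·g₂`, then `g₂ ≤ g₁`. -/
theorem genus_le_of_surjective_free_commutator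
    {G H : Type*} [Group G] [Group H] (φ : G →* H) (hφ : Function.Surjective φ)
    (g₁ g₂ : ℕ)
    (hG : Nonempty ((commutator G) ≃* FreeGroup (Fin (2 * g₁))))
    (hH : Nonempty ((commutator H) ≃* FreeGroup (Fin (2 * g₂)))) :
    g₂ ≤ g₁ := by
  obtain ⟨eG⟩ := hG
  obtain ⟨eH⟩ := hH
  let e := (MulEquiv.subgroupCongr (map_commutator_eq_of_surjective φ hφ)).trans eH
  let f : FreeGroup (Fin (2 * g₁)) →* FreeGroup (Fin (2 * g₂)) :=
    (e.toMonoidHom.comp (φ.subgroupMap (commutator G))).comp eG.symm.toMonoidHom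
  have hf : Function.Surjective f :=
    (e.surjective.comp (φ.subgroupMap_surjective (commutator G))).comp eG.symm.surjective
  have h := FreeGroup.card_le_of_surjective f hf
  simp only [Fintype.card_fin] at h
  omega
end

section
/- In the polynomial ring ℂ[M, L] in two variables (e.g., MvPolynomial (Fin 2) ℂ with M = X 0 and L = X 1), the polynomial p = 1 + M^6·L satisfies: (1) p divides 1 + M^18·L^3; (2) p is irreducible; (3) p does not divide 1 + M^18·L; and (4) p does not divide M^18 + L. -/
/-- A point with `M = 2`, `L = -1/64` lies on the curve `1 + M^6·L = 0`, so every multiple of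
`1 + M^6·L` vanishes there. -/
theorem MvPolynomial.eval_eq_zero_of_one_add_X_pow_six_mul_X_dvd
    {q : MvPolynomial (Fin 2) ℂ}
    (h : (1 + MvPolynomial.X 0 ^ 6 * MvPolynomial.X 1) ∣ q) :
    MvPolynomial.eval ![2, -1 / 64] q = 0 := by
  obtain ⟨r, rfl⟩ := h
  simp only [map_mul, map_add, map_one, map_pow, MvPolynomial.eval_X, Matrix.cons_val_zero,
    Matrix.cons_val_one]
  norm_num

/-- In `ℂ[M, L]` (with `M = X 0`, `L = X 1`), the A-polynomial `1 + M^6·L` of the trefoil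
divides `1 + M^18·L^3`, is irreducible, and divides neither `1 + M^18·L` nor `M^18 + L`. -/
theorem trefoil_A_polynomial_divisibility
    (M L : MvPolynomial (Fin 2) ℂ)
    (hM : M = MvPolynomial.X 0) (hL : L = MvPolynomial.X 1) :
    (1 + M ^ 6 * L) ∣ (1 + M ^ 18 * L ^ 3) ∧
    Irreducible (1 + M ^ 6 * L) ∧
    ¬ (1 + M ^ 6 * L) ∣ (1 + M ^ 18 * L) ∧
    ¬ (1 + M ^ 6 * L) ∣ (M ^ 18 + L) := by
  subst hM hL
  refine ⟨⟨1 - MvPolynomial.X 0 ^ 6 * MvPolynomial.X 1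
    + MvPolynomial.X 0 ^ 12 * MvPolynomial.X 1 ^ 2, by ring⟩, ?_, fun h => ?_, fun h => ?_⟩
  · have key := MvPolynomial.irreducible_mul_X_add
      (MvPolynomial.X 0 ^ 6 : MvPolynomial (Fin 2) ℂ) 1 1
      (pow_ne_zero _ (MvPolynomial.X_ne_zero 0))
      (fun h => by simpa using MvPolynomial.vars_pow _ _ h) (by simp) isRelPrime_one_right
    rwa [add_comm] at key
  all_goals
    have := MvPolynomial.eval_eq_zero_of_one_add_X_pow_six_mul_X_dvd h
    simp only [map_mul, map_add, map_one, map_pow, MvPolynomial.eval_X, Matrix.cons_val_zero,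
      Matrix.cons_val_one] at this
    norm_num at this
end

section
/- The presented group ⟨x, y, z, w ∣ zx = yz, yw = zy, wx = zw⟩ (the quotient of the free group on four generators by the normal closure of the relators z·x·z⁻¹·y⁻¹, y·w·y⁻¹·z⁻¹, w·x·w⁻¹·z⁻¹) is isomorphic to the presented group ⟨x, y ∣ x⁻¹·y⁻¹·x·y⁻¹·x⁻¹·y·x·y⁻¹·x·y⟩ (the quotient of the free group on two generators by the normal closure of the single relator x⁻¹y⁻¹xy⁻¹x⁻¹yxy⁻¹xy), under an isomorphism carrying x to x and y to y. -/
/-- The Wirtinger relations of the figure eight knot express `w` and `z` through `x` and `y`. -/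
theorem figureEight_eliminate {G : Type*} [Group G] {x y z w : G}
    (h₁ : z * x * z⁻¹ * y⁻¹ = 1) (h₂ : y * w * y⁻¹ * z⁻¹ = 1) (h₃ : w * x * w⁻¹ * z⁻¹ = 1) :
    w = x⁻¹ * y * x ∧ z = y * x⁻¹ * y * x * y⁻¹ := by
  have hz : z = y * w * y⁻¹ := (mul_inv_eq_one.mp h₂).symm
  subst hz
  have hw : w * y⁻¹ * x = y * w * y⁻¹ := by
    have h := mul_inv_eq_iff_eq_mul.mp (mul_inv_eq_one.mp h₁)
    apply mul_left_cancel (a := y)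
    simpa only [mul_assoc] using h
  have hx : w * x = w * (y⁻¹ * x * w) := by
    rw [mul_inv_eq_iff_eq_mul.mp (mul_inv_eq_one.mp h₃), ← hw]
    group
  have hxw : w = x⁻¹ * y * x := by
    have h := mul_left_cancel hx
    calc w = x⁻¹ * y * (y⁻¹ * x * w) := by group
      _ = x⁻¹ * y * x := by rw [← h]
  exact ⟨hxw, by rw [hxw]; group⟩

/-- The Wirtinger relations of the figure eight knot imply the two-generator relation. -/
theorem figureEight_relator_eq_one {G : Type*} [Group G] {x y z w : G}
    (h₁ : z * x * z⁻¹ * y⁻¹ = 1) (h₂ : y * w * y⁻¹ * z⁻¹ = 1) (h₃ : w * x * w⁻¹ * z⁻¹ = 1) :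
    x⁻¹ * y⁻¹ * x * y⁻¹ * x⁻¹ * y * x * y⁻¹ * x * y = 1 := by
  obtain ⟨-, rfl⟩ := figureEight_eliminate h₁ h₂ h₃
  rw [← conj_eq_one_iff (a := y * x⁻¹ * y * x * y⁻¹ * x * y), ← h₁]
  group

/-- The two-generator relation of the figure eight knot group implies the Wirtinger relations. -/
theorem figureEight_wirtinger_relators_eq_one {G : Type*} [Group G] {x y z w : G}
    (hw : w = x⁻¹ * y * x) (hz : z = y * x⁻¹ * y * x * y⁻¹)
    (h : x⁻¹ * y⁻¹ * x * y⁻¹ * x⁻¹ * y * x * y⁻¹ * x * y = 1) :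
    z * x * z⁻¹ * y⁻¹ = 1 ∧ y * w * y⁻¹ * z⁻¹ = 1 ∧ w * x * w⁻¹ * z⁻¹ = 1 := by
  subst hw hz
  refine ⟨?_, by group, ?_⟩
  · rw [← conj_eq_one_iff (a := y * x⁻¹ * y * x * y⁻¹ * x * y)] at h
    rw [← h]
    group
  · rw [← conj_eq_one_iff (a := x⁻¹ * y * x * y⁻¹ * x * y)] at h
    rw [← h]
    group

/-- The presented group `⟨x, y, z, w ∣ zx = yz, yw = zy, wx = zw⟩` (Wirtinger presentation
of the figure eight knot group) is isomorphic to the one-relator presented group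
`⟨x, y ∣ x⁻¹·y⁻¹·x·y⁻¹·x⁻¹·y·x·y⁻¹·x·y⟩`, by an isomorphism carrying `x` to `x`
and `y` to `y`. -/
theorem figure_eight_two_generator_presentation
    (x y z w : FreeGroup (Fin 4))
    (hx : x = FreeGroup.of 0) (hy : y = FreeGroup.of 1)
    (hz : z = FreeGroup.of 2) (hw : w = FreeGroup.of 3)
    (x' y' : FreeGroup (Fin 2))
    (hx' : x' = FreeGroup.of 0) (hy' : y' = FreeGroup.of 1)
    (rels₁ : Set (FreeGroup (Fin 4)))
    (hrels₁ : rels₁ = {z * x * z⁻¹ * y⁻¹, y * w * y⁻¹ * z⁻¹, w * x * w⁻¹ * z⁻¹})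
    (rels₂ : Set (FreeGroup (Fin 2)))
    (hrels₂ : rels₂ = {x'⁻¹ * y'⁻¹ * x' * y'⁻¹ * x'⁻¹ * y' * x' * y'⁻¹ * x' * y'}) :
    ∃ e : PresentedGroup rels₁ ≃* PresentedGroup rels₂,
      e (PresentedGroup.of 0) = PresentedGroup.of 0 ∧
      e (PresentedGroup.of 1) = PresentedGroup.of 1 := by
  subst hx hy hz hw hx' hy' hrels₁ hrels₂
  set R₁ : Set (FreeGroup (Fin 4)) := {_, _, _}
  set R₂ : Set (FreeGroup (Fin 2)) := {_}
  let a (i : Fin 4) : PresentedGroup R₁ := PresentedGroup.of i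
  let b (i : Fin 2) : PresentedGroup R₂ := PresentedGroup.of i
  have h₁ : a 2 * a 0 * (a 2)⁻¹ * (a 1)⁻¹ = 1 :=
    PresentedGroup.one_of_mem (rels := R₁) (by simp [R₁])
  have h₂ : a 1 * a 3 * (a 1)⁻¹ * (a 2)⁻¹ = 1 :=
    PresentedGroup.one_of_mem (rels := R₁) (by simp [R₁])
  have h₃ : a 3 * a 0 * (a 3)⁻¹ * (a 2)⁻¹ = 1 :=
    PresentedGroup.one_of_mem (rels := R₁) (by simp [R₁])
  have h : (b 0)⁻¹ * (b 1)⁻¹ * b 0 * (b 1)⁻¹ * (b 0)⁻¹ * b 1 * b 0 * (b 1)⁻¹ * b 0 * b 1 = 1 :=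
    PresentedGroup.one_of_mem (rels := R₂) (Set.mem_singleton _)
  obtain ⟨hw, hz⟩ := figureEight_eliminate h₁ h₂ h₃
  obtain ⟨k₁, k₂, k₃⟩ := figureEight_wirtinger_relators_eq_one rfl rfl h
  let f : Fin 4 → PresentedGroup R₂ :=
    ![b 0, b 1, b 1 * (b 0)⁻¹ * b 1 * b 0 * (b 1)⁻¹, (b 0)⁻¹ * b 1 * b 0]
  let g : Fin 2 → PresentedGroup R₁ := ![a 0, a 1]
  have hf : ∀ r ∈ R₁, FreeGroup.lift f r = 1 := by
    rintro r (rfl | rfl | rfl)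
    · simp only [map_mul, map_inv, FreeGroup.lift_apply_of]
      exact k₁
    · simp only [map_mul, map_inv, FreeGroup.lift_apply_of]
      exact k₂
    · simp only [map_mul, map_inv, FreeGroup.lift_apply_of]
      exact k₃
  have hg : ∀ r ∈ R₂, FreeGroup.lift g r = 1 := by
    rintro r rfl
    simp only [map_mul, map_inv, FreeGroup.lift_apply_of]
    exact figureEight_relator_eq_one h₁ h₂ h₃
  let F := PresentedGroup.toGroup hf
  let K := PresentedGroup.toGroup hg
  have hF (i : Fin 4) : F (a i) = f i := PresentedGroup.toGroup.of hf
  have hK (i : Fin 2) : K (b i) = g i := PresentedGroup.toGroup.of hg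
  have hK₀ : K (b 0) = a 0 := hK 0
  have hK₁ : K (b 1) = a 1 := hK 1
  have hKF : K.comp F = MonoidHom.id _ := by
    refine PresentedGroup.ext fun i => ?_
    change K (F (a i)) = a i
    rw [hF]
    fin_cases i
    · exact hK₀
    · exact hK₁
    · simpa [f, hK₀, hK₁] using hz.symm
    · simpa [f, hK₀, hK₁] using hw.symm
  have hFK : F.comp K = MonoidHom.id _ := by
    refine PresentedGroup.ext fun i => ?_
    change F (K (b i)) = b i
    rw [hK]
    fin_cases i
    · exact hF 0
    · exact hF 1
  exact ⟨F.toMulEquiv K hKF hFK, hF 0, hF 1⟩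
end
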